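/- For each odd n with 3 ≤ n ≤ 15 (i.e. n ∈ {3, 5, 7, 9, 11, 13, 15}), there exists no quadruple of integers (α₁, α₂, α₃, α₄) with 1 ≤ αᵢ ≤ n−1 satisfying conditions (2.14). Hence the linear construction yields no four-dimensional pandiagonal Latin cube of odd order n < 17. -/

import Mathlib

/-- Conditions (2.14) on the parameters `α₁, α₂, α₃, α₄` of a linear hypercube modulo
`n`, with `B = α₁ + α₂ + α₃ + α₄`. -/
def Cond214 (n : ℕ) (α₁ α₂ α₃ α₄ : ℤ) : Prop :=
  let a : Fin 4 → ℤ := ![α₁, α₂, α₃, α₄]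
  let B : ℤ := α₁ + α₂ + α₃ + α₄
  (∀ m, Int.gcd (a m) n = 1) ∧
  (∀ m m', m ≠ m' → Int.gcd (a m + a m') n = 1) ∧
  (∀ m m', m ≠ m' → Int.gcd (a m - a m') n = 1) ∧
  Int.gcd B n = 1 ∧
  (∀ m, Int.gcd (B - a m) n = 1) ∧
  (∀ m, Int.gcd (B - 2 * a m) n = 1) ∧
  (∀ m m', m ≠ m' → Int.gcd (B - a m' - 2 * a m) n = 1) ∧
  (∀ m m', m ≠ m' → Int.gcd (B - 2 * a m' - 2 * a m) n = 1)

/-- An integer coprime to `n` is nonzero modulo every prime divisor `p` of `n`. -/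
theorem cast_ne_zero_of_gcd {p n : ℕ} (hp : p.Prime) (hpn : p ∣ n) {x : ℤ}
    (h : Int.gcd x n = 1) : (x : ZMod p) ≠ 0 := by
  intro h0
  rw [ZMod.intCast_zmod_eq_zero_iff_dvd] at h0
  have h1 : p ∣ Int.gcd x n := Int.dvd_gcd h0 (by exact_mod_cast hpn)
  rw [h] at h1
  exact hp.one_lt.ne' (Nat.dvd_one.mp h1)

/-- The normalized search (`α₁ = 1`) modulo `p`, with the conditions tested as early as
possible. -/
def NoNormalized (p : ℕ) : Prop :=
  ∀ b : ZMod p, b ≠ 0 → 1 + b ≠ 0 → 1 - b ≠ 0 →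
    ∀ c : ZMod p, c ≠ 0 → 1 + c ≠ 0 → 1 - c ≠ 0 → b + c ≠ 0 → b - c ≠ 0 → 1 + b + c ≠ 0 →
      ∀ d : ZMod p, d ≠ 0 → 1 + d ≠ 0 → 1 - d ≠ 0 → b + d ≠ 0 → b - d ≠ 0 →
        c + d ≠ 0 → c - d ≠ 0 →
        1 + b + d ≠ 0 → 1 + c + d ≠ 0 → b + c + d ≠ 0 → 1 + b + c + d ≠ 0 →
        b + c + d - 1 ≠ 0 → 1 + c + d - b ≠ 0 → 1 + b + d - c ≠ 0 → 1 + b + c - d ≠ 0 →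
        c + d - 1 ≠ 0 → b + d - 1 ≠ 0 → b + c - 1 ≠ 0 →
        c + d - b ≠ 0 → 1 + d - b ≠ 0 → 1 + c - b ≠ 0 →
        b + d - c ≠ 0 → 1 + d - c ≠ 0 → 1 + b - c ≠ 0 →
        b + c - d ≠ 0 → 1 + c - d ≠ 0 → 1 + b - d ≠ 0 →
        c + d - 1 - b ≠ 0 → b + d - 1 - c ≠ 0 → b + c - 1 - d ≠ 0 → False

set_option synthInstance.maxHeartbeats 2000000 in
set_option synthInstance.maxSize 4000 in
set_option maxRecDepth 10000 in
theorem noNormalized_three : NoNormalized 3 := by unfold NoNormalized; decide +kernel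
set_option synthInstance.maxHeartbeats 2000000 in
set_option synthInstance.maxSize 4000 in
set_option maxRecDepth 10000 in
theorem noNormalized_five : NoNormalized 5 := by unfold NoNormalized; decide +kernel
set_option synthInstance.maxHeartbeats 2000000 in
set_option synthInstance.maxSize 4000 in
set_option maxRecDepth 10000 in
theorem noNormalized_seven : NoNormalized 7 := by unfold NoNormalized; decide +kernel
set_option synthInstance.maxHeartbeats 2000000 in
set_option synthInstance.maxSize 4000 in
set_option maxRecDepth 10000 in
theorem noNormalized_eleven : NoNormalized 11 := by unfold NoNormalized; decide +kernel
set_option synthInstance.maxHeartbeats 2000000 in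
set_option synthInstance.maxSize 4000 in
set_option maxRecDepth 10000 in
theorem noNormalized_thirteen : NoNormalized 13 := by unfold NoNormalized; decide +kernel

set_option linter.unusedSimpArgs false in
/-- Dividing by `α₁` modulo a prime divisor `p` of `n` reduces to the normalized search. -/
theorem not_cond_of_noNormalized {p n : ℕ} (hp : p.Prime) (hpn : p ∣ n) (H : NoNormalized p)
    (x y z w : ℤ) : ¬ Cond214 n x y z w := by
  have : Fact p.Prime := ⟨hp⟩
  rintro ⟨h1, h2, h3, h4, h5, h6, h7, h8⟩
  have key : ∀ (t : ℤ) (s : ZMod p), Int.gcd t n = 1 → (t : ZMod p) = x * s → s ≠ 0 := by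
    intro t s ht hts hs
    apply cast_ne_zero_of_gcd hp hpn ht
    rw [hts, hs, mul_zero]
  have hx : (x : ZMod p) ≠ 0 := cast_ne_zero_of_gcd hp hpn (h1 0)
  obtain ⟨b, hb⟩ : ∃ b : ZMod p, (y : ZMod p) = x * b := ⟨y / x, by field_simp⟩
  obtain ⟨c, hc⟩ : ∃ c : ZMod p, (z : ZMod p) = x * c := ⟨z / x, by field_simp⟩
  obtain ⟨d, hd⟩ : ∃ d : ZMod p, (w : ZMod p) = x * d := ⟨w / x, by field_simp⟩
  exact H b (key _ _ (h1 1) (by simp [hb, hc, hd]; try ring)) (key _ _ (h2 0 1 (by decide)) (by simp [hb, hc, hd]; try ring)) (key _ _ (h3 0 1 (by decide)) (by simp [hb, hc, hd]; try ring))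
    c (key _ _ (h1 2) (by simp [hb, hc, hd]; try ring))
    (key _ _ (h2 0 2 (by decide)) (by simp [hb, hc, hd]; try ring))
    (key _ _ (h3 0 2 (by decide)) (by simp [hb, hc, hd]; try ring))
    (key _ _ (h2 1 2 (by decide)) (by simp [hb, hc, hd]; try ring))
    (key _ _ (h3 1 2 (by decide)) (by simp [hb, hc, hd]; try ring))
    (key _ _ (h5 3) (by simp [hb, hc, hd]; try ring))
    d (key _ _ (h1 3) (by simp [hb, hc, hd]; try ring))
    (key _ _ (h2 0 3 (by decide)) (by simp [hb, hc, hd]; try ring))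
    (key _ _ (h3 0 3 (by decide)) (by simp [hb, hc, hd]; try ring))
    (key _ _ (h2 1 3 (by decide)) (by simp [hb, hc, hd]; try ring))
    (key _ _ (h3 1 3 (by decide)) (by simp [hb, hc, hd]; try ring))
    (key _ _ (h2 2 3 (by decide)) (by simp [hb, hc, hd]; try ring))
    (key _ _ (h3 2 3 (by decide)) (by simp [hb, hc, hd]; try ring))
    (key _ _ (h5 2) (by simp [hb, hc, hd]; try ring))
    (key _ _ (h5 1) (by simp [hb, hc, hd]; try ring))
    (key _ _ (h5 0) (by simp [hb, hc, hd]; try ring))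
    (key _ _ (h4) (by simp [hb, hc, hd]; try ring))
    (key _ _ (h6 0) (by simp [hb, hc, hd]; try ring))
    (key _ _ (h6 1) (by simp [hb, hc, hd]; try ring))
    (key _ _ (h6 2) (by simp [hb, hc, hd]; try ring))
    (key _ _ (h6 3) (by simp [hb, hc, hd]; try ring))
    (key _ _ (h7 0 1 (by decide)) (by simp [hb, hc, hd]; try ring))
    (key _ _ (h7 0 2 (by decide)) (by simp [hb, hc, hd]; try ring))
    (key _ _ (h7 0 3 (by decide)) (by simp [hb, hc, hd]; try ring))
    (key _ _ (h7 1 0 (by decide)) (by simp [hb, hc, hd]; try ring))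
    (key _ _ (h7 1 2 (by decide)) (by simp [hb, hc, hd]; try ring))
    (key _ _ (h7 1 3 (by decide)) (by simp [hb, hc, hd]; try ring))
    (key _ _ (h7 2 0 (by decide)) (by simp [hb, hc, hd]; try ring))
    (key _ _ (h7 2 1 (by decide)) (by simp [hb, hc, hd]; try ring))
    (key _ _ (h7 2 3 (by decide)) (by simp [hb, hc, hd]; try ring))
    (key _ _ (h7 3 0 (by decide)) (by simp [hb, hc, hd]; try ring))
    (key _ _ (h7 3 1 (by decide)) (by simp [hb, hc, hd]; try ring))
    (key _ _ (h7 3 2 (by decide)) (by simp [hb, hc, hd]; try ring))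
    (key _ _ (h8 0 1 (by decide)) (by simp [hb, hc, hd]; try ring))
    (key _ _ (h8 0 2 (by decide)) (by simp [hb, hc, hd]; try ring))
    (key _ _ (h8 0 3 (by decide)) (by simp [hb, hc, hd]; try ring))

/-- For each odd `n` with `3 ≤ n ≤ 15` there is no quadruple
`(α₁,α₂,α₃,α₄)` of integers with `1 ≤ αᵢ ≤ n-1` satisfying conditions (2.14); so the
linear construction yields no four-dimensional pandiagonal Latin cube of odd order
`n < 17`. -/
theorem no_pandiagonal_hypercube_parameters_below_seventeen :
    ∀ n : ℕ, n ∈ ({3, 5, 7, 9, 11, 13, 15} : Set ℕ) →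
      ¬ ∃ α₁ α₂ α₃ α₄ : ℤ,
          (1 ≤ α₁ ∧ α₁ ≤ (n : ℤ) - 1) ∧
          (1 ≤ α₂ ∧ α₂ ≤ (n : ℤ) - 1) ∧
          (1 ≤ α₃ ∧ α₃ ≤ (n : ℤ) - 1) ∧
          (1 ≤ α₄ ∧ α₄ ≤ (n : ℤ) - 1) ∧
          Cond214 n α₁ α₂ α₃ α₄ := by
  rintro n hn ⟨x, y, z, w, -, -, -, -, h⟩
  simp only [Set.mem_insert_iff, Set.mem_singleton_iff] at hn
  rcases hn with rfl | rfl | rfl | rfl | rfl | rfl | rfl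
  · exact not_cond_of_noNormalized (p := 3) (by norm_num) (by norm_num) noNormalized_three _ _ _ _ h
  · exact not_cond_of_noNormalized (p := 5) (by norm_num) (by norm_num) noNormalized_five _ _ _ _ h
  · exact not_cond_of_noNormalized (p := 7) (by norm_num) (by norm_num) noNormalized_seven _ _ _ _ h
  · exact not_cond_of_noNormalized (p := 3) (by norm_num) (by norm_num) noNormalized_three _ _ _ _ h
  · exact not_cond_of_noNormalized (p := 11) (by norm_num) (by norm_num) noNormalized_eleven
      _ _ _ _ h
  · exact not_cond_of_noNormalized (p := 13) (by norm_num) (by norm_num) noNormalized_thirteen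
      _ _ _ _ h
  · exact not_cond_of_noNormalized (p := 3) (by norm_num) (by norm_num) noNormalized_three _ _ _ _ h
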